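/- For every v ∈ Sₙ the matrix elements F_v satisfy the exchange relations. For 1 ≤ i ≤ n−1, writing τ_i F_v for F_v with x_i and x_{i+1} interchanged: if ℓ(s_i v) > ℓ(v) then (1 − t·x_{i+1}/x_i)·τ_i F_v = (1−t)·F_v + (1 − x_{i+1}/x_i)·F_{s_i v}, and if ℓ(s_i v) < ℓ(v) then (1 − t·x_{i+1}/x_i)·τ_i F_v = (1−t)(x_{i+1}/x_i)·F_v + t(1 − x_{i+1}/x_i)·F_{s_i v}. For 1 ≤ j ≤ n−1, writing τ'_j F_v for F_v with y_j and y_{j+1} interchanged: if ℓ(v s_j) > ℓ(v) then (1 − t·y_j/y_{j+1})·τ'_j F_v = (1−t)·F_v + (1 − y_j/y_{j+1})·F_{v s_j}, and if ℓ(v s_j) < ℓ(v) then (1 − t·y_j/y_{j+1})·τ'_j F_v = (1−t)(y_j/y_{j+1})·F_v + t(1 − y_j/y_{j+1})·F_{v s_j}. -/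

import Mathlib

open Finset

noncomputable section

/-- The ambient field: fraction field of polynomials over `ℚ` in countably many
indeterminates; `qq`, `tt` and the `xx i`, `yy i` below are algebraically independent
indeterminates, so identities among them are identities of rational functions
in `q`, `t` and the `x i` (and `y i`) over `ℚ`. -/
abbrev F : Type := FractionRing (MvPolynomial ℕ ℚ)

def gen (i : ℕ) : F := algebraMap (MvPolynomial ℕ ℚ) F (MvPolynomial.X i)

/-- the indeterminate `q` -/
def qq : F := gen 0
/-- the indeterminate `t` -/
def tt : F := gen 1
/-- the indeterminate `x_{i+1}` (0-based) -/
def xx (i : ℕ) : F := gen (2 + 2 * i)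
/-- the indeterminate `y_{i+1}` (0-based) -/
def yy (i : ℕ) : F := gen (3 + 2 * i)

/-- labelings of the `2n` edge positions by values in `{1,…,n+1}` (0-based). -/
abbrev Lab (n : ℕ) := Fin (2 * n) → Fin (n + 1)

abbrev Mat (n : ℕ) := Matrix (Lab n) (Lab n) F

/-- the structure constant `c((a,b),(a',b'))` of the generator `T`. -/
def Tcoeff (n : ℕ) (a b a' b' : Fin (n + 1)) : F :=
  if a' = a ∧ b' = b ∧ b < a then tt - 1
  else if a' = b ∧ b' = a ∧ a < b then 1
  else if a' = b ∧ b' = a ∧ b ≤ a then tt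
  else 0

/-- the (standard, column-convention) matrix of `T_i` acting at 0-based positions `p, p+1`:
the `(κ, κ')` entry is the coefficient of `e_κ` in `T e_{κ'}`. -/
def Tmat (n : ℕ) (p : ℕ) : Mat n :=
  Matrix.of fun κ κ' =>
    if h : p + 1 < 2 * n then
      if ∀ j : Fin (2 * n), (j : ℕ) ≠ p → (j : ℕ) ≠ p + 1 → κ j = κ' j then
        Tcoeff n (κ' ⟨p, by omega⟩) (κ' ⟨p + 1, h⟩) (κ ⟨p, by omega⟩) (κ ⟨p + 1, h⟩)
      else 0
    else 0

/-- `Ř_i(u) = (1−t)·Id + (1−u)·T_i` at 0-based position `p`. -/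
def Rmat (n : ℕ) (p : ℕ) (u : F) : Mat n := (1 - tt) • (1 : Mat n) + (1 - u) • Tmat n p

/-- the ordered product `Z = ∏_{j=1}^{n} (Ř_{n+j−1}(xₙ/y_j)·Ř_{n+j−2}(x_{n−1}/y_j)⋯Ř_j(x₁/y_j))`,
columns `j = 1,…,n` multiplied left to right (matrices in the standard convention, so that
an operator product written left to right is the corresponding matrix product). -/
def Zmat (n : ℕ) (x y : ℕ → F) : Mat n :=
  ((List.range n).map fun j =>
    ((List.range n).map fun r => Rmat n (j + (n - 1 - r)) (x (n - 1 - r) / y j)).prod).prod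

/-- the labeling `(ω̄(v(1)),…,ω̄(v(2n)))` of `|v⟩` for `v ∈ Sₙ ⊂ S_{2n}`. -/
def labP (n : ℕ) (v : Equiv.Perm (Fin n)) : Lab n := fun p =>
  if h : (p : ℕ) < n then Fin.castSucc (v ⟨p, h⟩) else Fin.last n

/-- the number of inversions (Coxeter length) of a permutation. -/
def ell {n : ℕ} (v : Equiv.Perm (Fin n)) : ℕ :=
  ((Finset.univ : Finset (Fin n × Fin n)).filter fun p => p.1 < p.2 ∧ v p.2 < v p.1).card

/-- `αₙ = (q/t)^{n(n−1)/2} (1−t)^{−n}`. -/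
def alpha (n : ℕ) : F := (qq / tt) ^ (n * (n - 1) / 2) * (1 - tt)⁻¹ ^ n

/-- the matrix element `F_v = ⟨1| Z |v⟩`. -/
def Fv (n : ℕ) (x y : ℕ → F) (v : Equiv.Perm (Fin n)) : F :=
  Zmat n x y (labP n 1) (labP n v)

/-! ### Yang–Baxter equation and transport through columns -/

section Hecke

variable {A : Type*} [Ring A]

theorem smul_one_add_smul_mul_mul {K : Type*} [CommRing K] [Algebra K A] (a b c d : K) (X Y Z : A) :
    (a • 1 + b • X) * (a • 1 + c • Y) * (a • 1 + d • Z) =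
      (a * a * a) • (1 : A) + (a * a * b) • X + (a * a * c) • Y + (a * a * d) • Z +
        (a * b * c) • (X * Y) + (a * b * d) • (X * Z) + (a * c * d) • (Y * Z) +
        (b * c * d) • (X * Y * Z) := by
  simp only [mul_add, add_mul, smul_mul_assoc, mul_smul_comm, one_mul, mul_one]
  module

theorem yangBaxter_of_hecke {K : Type*} [CommRing K] [Algebra K A] (t u v : K) (X Y : A)
    (hX : X * X = (t - 1) • X + t • 1)
    (hY : Y * Y = (t - 1) • Y + t • 1) (hXY : X * Y * X = Y * X * Y) :
    ((1 - t) • 1 + (1 - u) • X) * ((1 - t) • 1 + (1 - u * v) • Y) *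
        ((1 - t) • 1 + (1 - v) • X) =
      ((1 - t) • 1 + (1 - v) • Y) * ((1 - t) • 1 + (1 - u * v) • X) *
        ((1 - t) • 1 + (1 - u) • Y) := by
  rw [smul_one_add_smul_mul_mul, smul_one_add_smul_mul_mul, hX, hY, hXY]
  module

/-- The product `R (j+m-1) (x (m-1) / y) ⋯ R j (x 0 / y)`. -/
def column (R : ℕ → F → A) (x : ℕ → F) (y : F) (j : ℕ) : ℕ → A
  | 0 => 1
  | m + 1 => R (j + m) (x m / y) * column R x y j m

theorem list_prod_eq_column (R : ℕ → F → A) (x : ℕ → F) (y : F) (j m : ℕ) :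
    ((List.range m).map fun r => R (j + (m - 1 - r)) (x (m - 1 - r) / y)).prod =
      column R x y j m := by
  induction m with
  | zero => simp [column]
  | succ m ih =>
    rw [List.range_succ_eq_map, List.map_cons, List.prod_cons, List.map_map, column, ← ih]
    refine congrArg _ (congrArg List.prod (List.map_congr_left fun r _ => ?_))
    have : m + 1 - 1 - (r + 1) = m - 1 - r := by omega
    simp only [Function.comp_apply, Nat.succ_eq_add_one, this]

variable {R : ℕ → F → A} {x : ℕ → F}

theorem commute_column_of_lt
    (hR : ∀ p q u v, p + 2 ≤ q → Commute (R p u) (R q v)) (y w : F) {p j : ℕ} (h : p + 2 ≤ j)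
    (m : ℕ) : Commute (R p w) (column R x y j m) := by
  induction m with
  | zero => exact Commute.one_right _
  | succ m ih => exact (hR _ _ _ _ (by omega)).mul_right ih

theorem commute_column_of_gt
    (hR : ∀ p q u v, p + 2 ≤ q → Commute (R p u) (R q v)) (y w : F) {p j m : ℕ}
    (h : j + m + 1 ≤ p) : Commute (R p w) (column R x y j m) := by
  induction m with
  | zero => exact Commute.one_right _
  | succ m ih => exact (hR _ _ _ _ (by omega)).symm.mul_right (ih (by omega))

theorem column_mul_column_mul {N : ℕ}
    (hR : ∀ p q u v, p + 2 ≤ q → Commute (R p u) (R q v))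
    (hYB : ∀ p u v, p + 2 < N →
      R p u * R (p + 1) (u * v) * R p v = R (p + 1) v * R p (u * v) * R (p + 1) u)
    {y z : F} (hy : y ≠ 0) (j m : ℕ) (hm : j + m + 1 < N) :
    column R x y j m * column R x z (j + 1) m * R j (y / z) =
      R (j + m) (y / z) * (column R x z j m * column R x y (j + 1) m) := by
  induction m with
  | zero => simp [column]
  | succ m ih =>
    have hyb := hYB (j + m) (x m / y) (y / z) (by omega)
    rw [div_mul_div_cancel₀ hy] at hyb
    have c1 := (commute_column_of_gt (x := x) hR y (x m / z) (p := j + m + 1) (j := j) (m := m)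
      le_rfl).eq
    have c2 := (commute_column_of_gt (x := x) hR z (x m / y) (p := j + m + 1) (j := j) (m := m)
      le_rfl).eq
    have ih := ih (by omega)
    simp only [column]
    rw [show j + 1 + m = j + m + 1 by omega, show j + (m + 1) = j + m + 1 by omega]
    calc _ = R (j + m) (x m / y) * (column R x y j m * R (j + m + 1) (x m / z)) *
              column R x z (j + 1) m * R j (y / z) := by simp only [mul_assoc]
      _ = R (j + m) (x m / y) * R (j + m + 1) (x m / z) *
            (column R x y j m * column R x z (j + 1) m * R j (y / z)) := by
          rw [← c1]; simp only [mul_assoc]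
      _ = R (j + m) (x m / y) * R (j + m + 1) (x m / z) * R (j + m) (y / z) *
            (column R x z j m * column R x y (j + 1) m) := by
          rw [ih]; simp only [mul_assoc]
      _ = R (j + m + 1) (y / z) * R (j + m) (x m / z) *
            (R (j + m + 1) (x m / y) * column R x z j m) * column R x y (j + 1) m := by
          rw [hyb]; simp only [mul_assoc]
      _ = _ := by rw [c2]; simp only [mul_assoc]

theorem column_congr {x x' : ℕ → F} (y : F) (j : ℕ) {m : ℕ} (h : ∀ k < m, x k = x' k) :
    column R x y j m = column R x' y j m := by
  induction m with
  | zero => rfl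
  | succ m ih => rw [column, column, h m (by omega), ih fun k hk => h k (by omega)]

/-- The sequence `x` with the entries `i` and `i + 1` interchanged. -/
abbrev swapSeq (x : ℕ → F) (i : ℕ) : ℕ → F :=
  fun k => if k = i then x (i + 1) else if k = i + 1 then x i else x k

theorem column_mul_of_swapSeq {N : ℕ}
    (hR : ∀ p q u v, p + 2 ≤ q → Commute (R p u) (R q v))
    (hYB : ∀ p u v, p + 2 < N →
      R p u * R (p + 1) (u * v) * R p v = R (p + 1) v * R p (u * v) * R (p + 1) u)
    {y : F} {i : ℕ} (hx : x (i + 1) ≠ 0) (j m : ℕ) (him : i + 2 ≤ m) (hN : j + i + 2 < N) :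
    column R x y j m * R (j + i + 1) (x i / x (i + 1)) =
      R (j + i) (x i / x (i + 1)) * column R (swapSeq x i) y j m := by
  induction m, him using Nat.le_induction with
  | base =>
    have hyb := hYB (j + i) (x i / x (i + 1)) (x (i + 1) / y) hN
    rw [div_mul_div_cancel₀ hx] at hyb
    have c := (commute_column_of_gt (x := x) hR y (x i / x (i + 1)) (p := j + i + 1) (j := j)
      (m := i) le_rfl).eq
    have hc : column R (swapSeq x i) y j i = column R x y j i :=
      column_congr _ _ fun k hk => by simp [swapSeq, show k ≠ i by omega, show k ≠ i + 1 by omega]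
    simp only [column]
    rw [hc]
    simp only [swapSeq, if_true, Nat.succ_ne_self, if_false, ← add_assoc]
    rw [mul_assoc, mul_assoc, ← c, ← mul_assoc, ← mul_assoc, ← hyb]
    simp only [mul_assoc]
  | succ m him ih =>
    rw [column, column, mul_assoc, ih, ← mul_assoc, ← mul_assoc,
      (hR (j + i) (j + m) _ _ (by omega)).eq]
    simp [swapSeq, show m ≠ i by omega, show m ≠ i + 1 by omega]

/-- The product of the columns `0, …, k - 1`, each with `m` factors. -/
def columns (R : ℕ → F → A) (x y : ℕ → F) (m : ℕ) : ℕ → A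
  | 0 => 1
  | k + 1 => columns R x y m k * column R x (y k) k m

theorem list_prod_eq_columns (R : ℕ → F → A) (x y : ℕ → F) (m k : ℕ) :
    ((List.range k).map fun j =>
      ((List.range m).map fun r => R (j + (m - 1 - r)) (x (m - 1 - r) / y j)).prod).prod =
      columns R x y m k := by
  induction k with
  | zero => simp [columns]
  | succ k ih => rw [List.range_succ, List.map_append, List.prod_append, ih, columns,
      List.map_singleton, List.prod_singleton, list_prod_eq_column]

theorem columns_congr {y y' : ℕ → F} (m : ℕ) {k : ℕ} (h : ∀ j < k, y j = y' j) :
    columns R x y m k = columns R x y' m k := by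
  induction k with
  | zero => rfl
  | succ k ih => rw [columns, columns, h k (by omega), ih fun j hj => h j (by omega)]

theorem commute_columns_of_gt
    (hR : ∀ p q u v, p + 2 ≤ q → Commute (R p u) (R q v)) (y : ℕ → F) (w : F) {p m k : ℕ}
    (h : k + m ≤ p) : Commute (R p w) (columns R x y m k) := by
  induction k with
  | zero => exact Commute.one_right _
  | succ k ih => exact (ih (by omega)).mul_right (commute_column_of_gt hR _ _ (by omega))

theorem columns_mul_of_swapSeq_right {N : ℕ}
    (hR : ∀ p q u v, p + 2 ≤ q → Commute (R p u) (R q v))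
    (hYB : ∀ p u v, p + 2 < N →
      R p u * R (p + 1) (u * v) * R p v = R (p + 1) v * R p (u * v) * R (p + 1) u)
    {y : ℕ → F} {j : ℕ} (hy : y j ≠ 0) (m k : ℕ) (hjk : j + 2 ≤ k) (hN : j + m + 1 < N) :
    columns R x y m k * R j (y j / y (j + 1)) =
      R (j + m) (y j / y (j + 1)) * columns R x (swapSeq y j) m k := by
  induction k, hjk using Nat.le_induction with
  | base =>
    have h := column_mul_column_mul (x := x) (z := y (j + 1)) hR hYB hy j m hN
    have c := (commute_columns_of_gt (x := x) hR y (y j / y (j + 1)) (p := j + m) (m := m)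
      (k := j) le_rfl).eq
    have hc : columns R x (swapSeq y j) m j = columns R x y m j :=
      columns_congr _ fun k hk => by simp [swapSeq, show k ≠ j by omega, show k ≠ j + 1 by omega]
    simp only [columns]
    rw [hc]
    simp only [swapSeq, if_true, Nat.succ_ne_self, if_false]
    rw [mul_assoc, mul_assoc, ← mul_assoc (column R x (y j) j m), h, ← mul_assoc, ← c]
    simp only [mul_assoc]
  | succ k hjk ih =>
    rw [columns, columns, mul_assoc, ← (commute_column_of_lt hR (y k) _ (by omega) m).eq,
      ← mul_assoc, ih, mul_assoc]
    simp [swapSeq, show k ≠ j by omega, show k ≠ j + 1 by omega]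

theorem columns_mul_of_swapSeq_left {N : ℕ}
    (hR : ∀ p q u v, p + 2 ≤ q → Commute (R p u) (R q v))
    (hYB : ∀ p u v, p + 2 < N →
      R p u * R (p + 1) (u * v) * R p v = R (p + 1) v * R p (u * v) * R (p + 1) u)
    {y : ℕ → F} {i : ℕ} (hx : x (i + 1) ≠ 0) (m k : ℕ) (him : i + 2 ≤ m) (hN : k + i + 1 < N) :
    columns R x y m k * R (k + i) (x i / x (i + 1)) =
      R i (x i / x (i + 1)) * columns R (swapSeq x i) y m k := by
  induction k with
  | zero => simp [columns]
  | succ k ih =>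
    rw [columns, columns, mul_assoc, show k + 1 + i = k + i + 1 by omega,
      column_mul_of_swapSeq hR hYB hx k m him (by omega), ← mul_assoc, ih (by omega), mul_assoc]

end Hecke

/-! ### The Hecke generators acting on functions of labelings -/

section Generators

open Matrix

variable {n : ℕ}

/-- The diagonal coefficient of a Hecke generator at adjacent labels `a, b`. -/
def diagCoeff {α : Type*} [LinearOrder α] (a b : α) : F := if b < a then tt - 1 else 0

/-- The off-diagonal coefficient of a Hecke generator, sending labels `b, a` to `a, b`. -/
def swapCoeff {α : Type*} [LinearOrder α] (a b : α) : F := if a < b then 1 else tt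

/-- The transposition of the positions `p` and `p + 1`. -/
def posSwap {N p : ℕ} (h : p + 1 < N) : Equiv.Perm (Fin N) :=
  Equiv.swap ⟨p, Nat.lt_of_succ_lt h⟩ ⟨p + 1, h⟩

theorem posSwap_left {N p : ℕ} (h : p + 1 < N) : posSwap h ⟨p, Nat.lt_of_succ_lt h⟩ = ⟨p + 1, h⟩ :=
  Equiv.swap_apply_left _ _

theorem posSwap_right {N p : ℕ} (h : p + 1 < N) :
    posSwap h ⟨p + 1, h⟩ = ⟨p, Nat.lt_of_succ_lt h⟩ :=
  Equiv.swap_apply_right _ _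

theorem posSwap_of_ne {N p : ℕ} (h : p + 1 < N) {j : Fin N} (h₁ : (j : ℕ) ≠ p)
    (h₂ : (j : ℕ) ≠ p + 1) : posSwap h j = j :=
  Equiv.swap_apply_of_ne_of_ne (fun e => h₁ (by rw [e])) (fun e => h₂ (by rw [e]))

theorem posSwap_posSwap {N p : ℕ} (h : p + 1 < N) (j : Fin N) : posSwap h (posSwap h j) = j :=
  Equiv.swap_apply_self _ _ _

theorem posSwap_mul_self {N p : ℕ} (h : p + 1 < N) : posSwap h * posSwap h = 1 :=
  Equiv.swap_mul_self _ _

theorem posSwap_inv {N p : ℕ} (h : p + 1 < N) : (posSwap h)⁻¹ = posSwap h :=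
  Equiv.swap_inv _ _

theorem posSwap_lt_posSwap {N p : ℕ} (h : p + 1 < N) {a b : Fin N} (hab : a < b)
    (hne : ¬ ((a : ℕ) = p ∧ (b : ℕ) = p + 1)) : posSwap h a < posSwap h b := by
  have ha : ((posSwap h a : Fin N) : ℕ) = if (a : ℕ) = p then p + 1 else
      if (a : ℕ) = p + 1 then p else a := by
    simp only [posSwap, Equiv.swap_apply_def, Fin.ext_iff]; split_ifs <;> rfl
  have hb : ((posSwap h b : Fin N) : ℕ) = if (b : ℕ) = p then p + 1 else
      if (b : ℕ) = p + 1 then p else b := by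
    simp only [posSwap, Equiv.swap_apply_def, Fin.ext_iff]; split_ifs <;> rfl
  rw [Fin.lt_def] at hab ⊢
  rw [ha, hb]
  split_ifs <;> omega

theorem Tmat_apply {p : ℕ} (h : p + 1 < 2 * n) (κ κ' : Lab n) :
    Tmat n p κ κ' =
      (if κ = κ' then diagCoeff (κ' ⟨p, by omega⟩) (κ' ⟨p + 1, h⟩) else 0) +
      if κ = κ' ∘ posSwap h then swapCoeff (κ' ⟨p, by omega⟩) (κ' ⟨p + 1, h⟩) else 0 := by
  have e₁ : κ = κ' ↔ (∀ j : Fin (2 * n), (j : ℕ) ≠ p → (j : ℕ) ≠ p + 1 → κ j = κ' j) ∧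
      κ ⟨p, by omega⟩ = κ' ⟨p, by omega⟩ ∧ κ ⟨p + 1, h⟩ = κ' ⟨p + 1, h⟩ := by
    refine ⟨fun e => by simp [e], fun ⟨h₀, h₁, h₂⟩ => funext fun j => ?_⟩
    by_cases hj : (j : ℕ) = p
    · rwa [show j = ⟨p, by omega⟩ from Fin.ext hj]
    by_cases hj' : (j : ℕ) = p + 1
    · rwa [show j = ⟨p + 1, h⟩ from Fin.ext hj']
    exact h₀ j hj hj'
  have e₂ : κ = κ' ∘ posSwap h ↔
      (∀ j : Fin (2 * n), (j : ℕ) ≠ p → (j : ℕ) ≠ p + 1 → κ j = κ' j) ∧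
      κ ⟨p, by omega⟩ = κ' ⟨p + 1, h⟩ ∧ κ ⟨p + 1, h⟩ = κ' ⟨p, by omega⟩ := by
    constructor
    · rintro rfl
      refine ⟨fun j h₁ h₂ => ?_, ?_, ?_⟩
      · simp [posSwap_of_ne h h₁ h₂]
      · simp [posSwap_left]
      · simp [posSwap_right]
    · rintro ⟨h₀, h₁, h₂⟩
      funext j
      by_cases hj : (j : ℕ) = p
      · rwa [show j = ⟨p, by omega⟩ from Fin.ext hj, Function.comp_apply, posSwap_left]
      by_cases hj' : (j : ℕ) = p + 1
      · rwa [show j = ⟨p + 1, h⟩ from Fin.ext hj', Function.comp_apply, posSwap_right]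
      rw [Function.comp_apply, posSwap_of_ne h hj hj', h₀ j hj hj']
  simp only [e₁, e₂, Tmat, Matrix.of_apply, h, dif_pos]
  by_cases h₀ : ∀ j : Fin (2 * n), (j : ℕ) ≠ p → (j : ℕ) ≠ p + 1 → κ j = κ' j
  · simp only [eq_true h₀, if_true, true_and, Tcoeff, diagCoeff, swapCoeff]
    generalize κ' ⟨p, _⟩ = a
    generalize κ' ⟨p + 1, _⟩ = b
    generalize κ ⟨p, _⟩ = a'
    generalize κ ⟨p + 1, _⟩ = b'
    rcases lt_trichotomy a b with hab | hab | hab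
    · simp [hab, hab.not_gt, hab.not_ge]
    · subst hab
      simp
    · by_cases h₁ : a' = a ∧ b' = b
      · obtain ⟨rfl, rfl⟩ := h₁
        simp [hab, hab.ne]
      · simp only [hab, hab.le, hab.not_gt, and_true, and_false, if_false, h₁, if_true, zero_add]
  · simp only [eq_false h₀, if_false, false_and, add_zero]

theorem vecMul_Tmat {p : ℕ} (h : p + 1 < 2 * n) (f : Lab n → F) (κ : Lab n) :
    (f ᵥ* Tmat n p) κ = diagCoeff (κ ⟨p, by omega⟩) (κ ⟨p + 1, h⟩) * f κ +
      swapCoeff (κ ⟨p, by omega⟩) (κ ⟨p + 1, h⟩) * f (κ ∘ posSwap h) := by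
  simp only [vecMul, dotProduct, Tmat_apply h, mul_add, Finset.sum_add_distrib, mul_ite, mul_zero,
    Finset.sum_ite_eq', Finset.mem_univ, if_true]
  ring

theorem Tmat_of_le {p : ℕ} (h : ¬ p + 1 < 2 * n) : Tmat n p = 0 := by
  ext κ κ'
  simp [Tmat, h]

theorem matrix_ext_vecMul {ι : Type*} [Fintype ι] {M N : Matrix ι ι F}
    (h : ∀ f κ, (f ᵥ* M) κ = (f ᵥ* N) κ) : M = N := by
  classical
  ext i j
  simpa using h (Pi.single i 1) j

theorem Tmat_comm {p q : ℕ} (hpq : p + 2 ≤ q) : Commute (Tmat n p) (Tmat n q) := by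
  by_cases hq : q + 1 < 2 * n
  swap
  · rw [Tmat_of_le hq]; exact Commute.zero_right _
  have hp : p + 1 < 2 * n := by omega
  refine matrix_ext_vecMul fun f κ => ?_
  simp only [← vecMul_vecMul]
  have h₁ : posSwap hp ⟨q, by omega⟩ = ⟨q, by omega⟩ :=
    posSwap_of_ne _ (by simp; omega) (by simp; omega)
  have h₂ : posSwap hp ⟨q + 1, hq⟩ = ⟨q + 1, hq⟩ :=
    posSwap_of_ne _ (by simp; omega) (by simp; omega)
  have h₃ : posSwap hq ⟨p, by omega⟩ = ⟨p, by omega⟩ :=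
    posSwap_of_ne _ (by simp; omega) (by simp; omega)
  have h₄ : posSwap hq ⟨p + 1, hp⟩ = ⟨p + 1, hp⟩ :=
    posSwap_of_ne _ (by simp; omega) (by simp; omega)
  have hs : (posSwap hp) ∘ (posSwap hq) = (posSwap hq) ∘ (posSwap hp) := by
    funext j
    by_cases a₁ : j = ⟨p, by omega⟩
    · rw [a₁]; simp [posSwap_left, h₃, h₄]
    by_cases a₂ : j = ⟨p + 1, by omega⟩
    · rw [a₂]; simp [posSwap_right, h₃, h₄]
    have b : posSwap hp j = j :=
      posSwap_of_ne _ (fun e => a₁ (Fin.ext e)) (fun e => a₂ (Fin.ext e))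
    by_cases a₃ : j = ⟨q, by omega⟩
    · rw [a₃]; simp [posSwap_left, h₁, h₂]
    by_cases a₄ : j = ⟨q + 1, by omega⟩
    · rw [a₄]; simp [posSwap_right, h₁, h₂]
    have c : posSwap hq j = j :=
      posSwap_of_ne _ (fun e => a₃ (Fin.ext e)) (fun e => a₄ (Fin.ext e))
    simp [b, c]
  simp only [vecMul_Tmat hp, vecMul_Tmat hq, Function.comp_apply, h₁, h₂, h₃, h₄,
    Function.comp_assoc, hs]
  ring

theorem Tmat_mul_self {p : ℕ} (h : p + 1 < 2 * n) :
    Tmat n p * Tmat n p = (tt - 1) • Tmat n p + tt • (1 : Mat n) := by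
  refine matrix_ext_vecMul fun f κ => ?_
  rw [← vecMul_vecMul, vecMul_add, vecMul_smul, vecMul_smul, vecMul_one]
  have hs : (κ ∘ posSwap h) ∘ posSwap h = κ := funext fun j => by simp [posSwap_posSwap]
  simp only [Pi.add_apply, Pi.smul_apply, vecMul_Tmat h, hs, Function.comp_apply, posSwap_left,
    posSwap_right, smul_eq_mul]
  rcases lt_trichotomy (κ ⟨p, by omega⟩) (κ ⟨p + 1, h⟩) with hab | hab | hab
  · simp [diagCoeff, swapCoeff, hab, hab.not_gt]
  · have : κ ∘ posSwap h = κ := by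
      funext j
      by_cases hj : (j : ℕ) = p
      · rw [show j = ⟨p, by omega⟩ from Fin.ext hj, Function.comp_apply, posSwap_left, hab]
      by_cases hj' : (j : ℕ) = p + 1
      · rw [show j = ⟨p + 1, h⟩ from Fin.ext hj', Function.comp_apply, posSwap_right, hab]
      rw [Function.comp_apply, posSwap_of_ne h hj hj']
    simp [diagCoeff, swapCoeff, hab, this]; ring
  · simp [diagCoeff, swapCoeff, hab, hab.not_gt]

/-- The labeling `κ` with the labels at `p, p + 1, p + 2` replaced by `a, b, c`. -/
def setTriple (κ : Lab n) (p : ℕ) (a b c : Fin (n + 1)) : Lab n := fun j =>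
  if (j : ℕ) = p then a else if (j : ℕ) = p + 1 then b else if (j : ℕ) = p + 2 then c else κ j

theorem setTriple_comp_posSwap {κ : Lab n} {p : ℕ} (h : p + 1 < 2 * n) (a b c : Fin (n + 1)) :
    setTriple κ p a b c ∘ posSwap h = setTriple κ p b a c := by
  funext j
  simp only [Function.comp_apply, setTriple, posSwap, Equiv.swap_apply_def, Fin.ext_iff]
  by_cases h₁ : (j : ℕ) = p
  · simp [h₁]
  by_cases h₂ : (j : ℕ) = p + 1 <;> simp [h₁, h₂]

theorem setTriple_comp_posSwap_succ {κ : Lab n} {p : ℕ} (h : p + 1 + 1 < 2 * n)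
    (a b c : Fin (n + 1)) :
    setTriple κ p a b c ∘ posSwap h = setTriple κ p a c b := by
  funext j
  simp only [Function.comp_apply, setTriple, posSwap, Equiv.swap_apply_def, Fin.ext_iff]
  by_cases h₁ : (j : ℕ) = p + 1
  · simp [h₁, show p + 1 + 1 ≠ p by omega]
  by_cases h₂ : (j : ℕ) = p + 2 <;> simp [h₁, h₂]

theorem Tmat_braid {p : ℕ} (h : p + 2 < 2 * n) :
    Tmat n p * Tmat n (p + 1) * Tmat n p = Tmat n (p + 1) * Tmat n p * Tmat n (p + 1) := by
  have hp : p + 1 < 2 * n := by omega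
  have hq : p + 1 + 1 < 2 * n := by omega
  refine matrix_ext_vecMul fun f κ => ?_
  obtain ⟨a, b, c, hκ⟩ : ∃ a b c, κ = setTriple κ p a b c := by
    refine ⟨κ ⟨p, by omega⟩, κ ⟨p + 1, by omega⟩, κ ⟨p + 2, h⟩, funext fun j => ?_⟩
    unfold setTriple
    split_ifs with h₁ h₂ h₃
    · exact congrArg κ (Fin.ext h₁)
    · exact congrArg κ (Fin.ext h₂)
    · exact congrArg κ (Fin.ext h₃)
    · rfl
  have T₁ : ∀ (g : Lab n → F) a b c, (g ᵥ* Tmat n p) (setTriple κ p a b c) =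
      diagCoeff a b * g (setTriple κ p a b c) + swapCoeff a b * g (setTriple κ p b a c) := by
    intro g a b c
    rw [vecMul_Tmat hp, setTriple_comp_posSwap]
    simp [setTriple]
  have T₂ : ∀ (g : Lab n → F) a b c, (g ᵥ* Tmat n (p + 1)) (setTriple κ p a b c) =
      diagCoeff b c * g (setTriple κ p a b c) + swapCoeff b c * g (setTriple κ p a c b) := by
    intro g a b c
    rw [vecMul_Tmat hq, setTriple_comp_posSwap_succ]
    simp [setTriple, show p + 1 + 1 ≠ p by omega]
  rw [hκ]
  simp only [← vecMul_vecMul, T₁, T₂]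
  clear hκ T₁ T₂
  unfold diagCoeff swapCoeff
  rcases lt_trichotomy a b with hab | hab | hab <;>
  rcases lt_trichotomy b c with hbc | hbc | hbc <;>
  rcases lt_trichotomy a c with hac | hac | hac <;>
  first
  | (exfalso; order)
  | (subst_vars; simp [*, LT.lt.not_gt]; try ring)

theorem Rmat_yangBaxter (p : ℕ) (u v : F) (h : p + 2 < 2 * n) :
    Rmat n p u * Rmat n (p + 1) (u * v) * Rmat n p v =
      Rmat n (p + 1) v * Rmat n p (u * v) * Rmat n (p + 1) u :=
  yangBaxter_of_hecke tt u v _ _ (Tmat_mul_self (by omega)) (Tmat_mul_self (by omega))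
    (Tmat_braid h)

theorem Rmat_comm (p q : ℕ) (u v : F) (h : p + 2 ≤ q) : Commute (Rmat n p u) (Rmat n q v) := by
  unfold Rmat
  have := Tmat_comm (n := n) h
  exact (((Commute.one_left _).smul_left _).add_left
    ((((Commute.one_right _).smul_right _).add_right (this.smul_right _)).smul_left _))

theorem Zmat_eq_columns (x y : ℕ → F) : Zmat n x y = columns (Rmat n) x y n n :=
  list_prod_eq_columns _ _ _ _ _

theorem vecMul_Rmat {p : ℕ} (f : Lab n → F) (u : F) :
    f ᵥ* Rmat n p u = (1 - tt) • f + (1 - u) • (f ᵥ* Tmat n p) := by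
  rw [Rmat, vecMul_add, vecMul_smul, vecMul_smul, vecMul_one]

/-! ### The action on colours -/

/-- The labels `a` and `b` each occur exactly once in `κ`, with `a` to the left of `b`. -/
def IsAscent (κ : Lab n) (a b : Fin (n + 1)) : Prop :=
  ∃ α β, α < β ∧ (∀ p, κ p = a ↔ p = α) ∧ ∀ p, κ p = b ↔ p = β

theorem IsAscent.not_reverse {κ : Lab n} {a b : Fin (n + 1)} (h : IsAscent κ a b) :
    ¬ IsAscent κ b a := by
  obtain ⟨α, β, hαβ, hα, hβ⟩ := h
  rintro ⟨β', α', hαβ', hβ', hα'⟩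
  obtain rfl : α = α' := (hα' α).1 ((hα α).2 rfl)
  obtain rfl : β = β' := (hβ' β).1 ((hβ β).2 rfl)
  exact hαβ.not_gt hαβ'

theorem IsAscent.comp_posSwap {κ : Lab n} {a b : Fin (n + 1)} (h : IsAscent κ a b) {p : ℕ}
    (hp : p + 1 < 2 * n) : IsAscent (κ ∘ posSwap hp) a b ∨
      (κ ⟨p, by omega⟩ = a ∧ κ ⟨p + 1, hp⟩ = b ∧ IsAscent (κ ∘ posSwap hp) b a) := by
  obtain ⟨α, β, hαβ, hα, hβ⟩ := h
  have key : ∀ {c : Fin (n + 1)} {γ : Fin (2 * n)}, (∀ q, κ q = c ↔ q = γ) →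
      ∀ q, (κ ∘ posSwap hp) q = c ↔ q = posSwap hp γ := by
    intro c γ h q
    rw [Function.comp_apply, h, ← posSwap_posSwap hp γ, (posSwap hp).injective.eq_iff,
      posSwap_posSwap]
  by_cases hne : (α : ℕ) = p ∧ (β : ℕ) = p + 1
  · obtain rfl : α = ⟨p, Nat.lt_of_succ_lt hp⟩ := Fin.ext hne.1
    obtain rfl : β = ⟨p + 1, hp⟩ := Fin.ext hne.2
    refine Or.inr ⟨(hα _).2 rfl, (hβ _).2 rfl, _, _, ?_, key hβ, key hα⟩
    rw [posSwap_left, posSwap_right]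
    exact hαβ
  · exact Or.inl ⟨_, _, posSwap_lt_posSwap hp hαβ hne, key hα, key hβ⟩

theorem IsAscent.swap_comp {κ : Lab n} {a b : Fin (n + 1)} (h : IsAscent κ a b) :
    IsAscent (Equiv.swap a b ∘ κ) b a := by
  obtain ⟨α, β, hαβ, hα, hβ⟩ := h
  refine ⟨α, β, hαβ, fun q => ?_, fun q => ?_⟩
  · rw [← hα, Function.comp_apply, Equiv.swap_apply_eq_iff, Equiv.swap_apply_right]
  · rw [← hβ, Function.comp_apply, Equiv.swap_apply_eq_iff, Equiv.swap_apply_left]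

open Classical in
/-- The Hecke generator exchanging the colours `a` and `b`, on labelings in which each occurs
exactly once. -/
def colorAct (a b : Fin (n + 1)) : (Lab n → F) →ₗ[F] (Lab n → F) where
  toFun f κ :=
    if IsAscent κ a b then f (Equiv.swap a b ∘ κ)
    else if IsAscent κ b a then (tt - 1) * f κ + tt * f (Equiv.swap a b ∘ κ)
    else 0
  map_add' f g := by
    funext κ
    simp only [Pi.add_apply]
    split_ifs <;> ring
  map_smul' c f := by
    funext κ
    simp only [Pi.smul_apply, smul_eq_mul, RingHom.id_apply]
    split_ifs <;> ring

theorem colorAct_of_isAscent {a b : Fin (n + 1)} (f : Lab n → F) {κ : Lab n}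
    (h : IsAscent κ a b) : colorAct a b f κ = f (Equiv.swap a b ∘ κ) :=
  if_pos h

theorem colorAct_of_isAscent_reverse {a b : Fin (n + 1)} (f : Lab n → F) {κ : Lab n}
    (h : IsAscent κ b a) :
    colorAct a b f κ = (tt - 1) * f κ + tt * f (Equiv.swap a b ∘ κ) :=
  (if_neg h.not_reverse).trans (if_pos h)

theorem colorAct_of_not {a b : Fin (n + 1)} (f : Lab n → F) {κ : Lab n}
    (h : ¬ IsAscent κ a b) (h' : ¬ IsAscent κ b a) : colorAct a b f κ = 0 :=
  (if_neg h).trans (if_neg h')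

theorem posSwap_lt_posSwap_iff {N i : ℕ} (hi : i + 1 < N) {a b : Fin N}
    (h₁ : ¬ ((a : ℕ) = i ∧ (b : ℕ) = i + 1)) (h₂ : ¬ ((a : ℕ) = i + 1 ∧ (b : ℕ) = i)) :
    posSwap hi a < posSwap hi b ↔ a < b := by
  refine ⟨fun h => ?_, fun h => posSwap_lt_posSwap hi h h₁⟩
  have := posSwap_lt_posSwap hi h ?_
  · rwa [posSwap_posSwap, posSwap_posSwap] at this
  · rintro ⟨ha, hb⟩
    have ha' : posSwap hi a = ⟨i, Nat.lt_of_succ_lt hi⟩ := Fin.ext ha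
    have hb' : posSwap hi b = ⟨i + 1, hi⟩ := Fin.ext hb
    apply h₂
    rw [← posSwap_posSwap hi a, ← posSwap_posSwap hi b, ha', hb', posSwap_left, posSwap_right]
    exact ⟨rfl, rfl⟩

theorem comp_posSwap_eq_swap_comp {κ : Lab n} {a b : Fin (n + 1)}
    (h : IsAscent κ a b ∨ IsAscent κ b a) {p : ℕ} (hp : p + 1 < 2 * n)
    (ha : κ ⟨p, by omega⟩ = a) (hb : κ ⟨p + 1, hp⟩ = b) :
    κ ∘ posSwap hp = Equiv.swap a b ∘ κ := by
  obtain ⟨α, β, hα, hβ⟩ : ∃ α β, (∀ p, κ p = a ↔ p = α) ∧ ∀ p, κ p = b ↔ p = β := by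
    rcases h with ⟨α, β, -, hα, hβ⟩ | ⟨β, α, -, hβ, hα⟩ <;> exact ⟨α, β, hα, hβ⟩
  obtain rfl := (hα _).1 ha
  obtain rfl := (hβ _).1 hb
  funext q
  simp only [Function.comp_apply]
  by_cases h₁ : (q : ℕ) = p
  · rw [show q = ⟨p, by omega⟩ from Fin.ext h₁, posSwap_left, ha, hb, Equiv.swap_apply_left]
  by_cases h₂ : (q : ℕ) = p + 1
  · rw [show q = ⟨p + 1, hp⟩ from Fin.ext h₂, posSwap_right, ha, hb, Equiv.swap_apply_right]
  rw [posSwap_of_ne hp h₁ h₂, Equiv.swap_apply_of_ne_of_ne]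
  · rw [Ne, hα]; exact fun e => h₁ (congrArg Fin.val e)
  · rw [Ne, hβ]; exact fun e => h₂ (congrArg Fin.val e)

theorem colorAct_vecMul_Tmat {i : ℕ} (hi : i + 1 < n + 1) (p : ℕ) (f : Lab n → F) :
    colorAct ⟨i, by omega⟩ ⟨i + 1, hi⟩ f ᵥ* Tmat n p =
      colorAct ⟨i, by omega⟩ ⟨i + 1, hi⟩ (f ᵥ* Tmat n p) := by
  by_cases hp : p + 1 < 2 * n
  swap
  · rw [Tmat_of_le hp, vecMul_zero, vecMul_zero, map_zero]
  set a : Fin (n + 1) := ⟨i, by omega⟩ with ha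
  set b : Fin (n + 1) := ⟨i + 1, hi⟩ with hb
  have hab : a < b := by simp [ha, hb, Fin.lt_def]
  have hσ : posSwap hi = Equiv.swap a b := rfl
  funext κ
  have hss : (κ ∘ posSwap hp) ∘ posSwap hp = κ := funext fun j => by simp [posSwap_posSwap]
  have hσσ : Equiv.swap a b ∘ Equiv.swap a b ∘ κ = κ := funext fun j => by simp
  have hcoeff : ¬ (κ ⟨p, by omega⟩ = a ∧ κ ⟨p + 1, hp⟩ = b) →
      ¬ (κ ⟨p, by omega⟩ = b ∧ κ ⟨p + 1, hp⟩ = a) →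
      diagCoeff (Equiv.swap a b (κ ⟨p, by omega⟩)) (Equiv.swap a b (κ ⟨p + 1, hp⟩)) =
        diagCoeff (κ ⟨p, by omega⟩) (κ ⟨p + 1, hp⟩) ∧
      swapCoeff (Equiv.swap a b (κ ⟨p, by omega⟩)) (Equiv.swap a b (κ ⟨p + 1, hp⟩)) =
        swapCoeff (κ ⟨p, by omega⟩) (κ ⟨p + 1, hp⟩) := by
    intro h₁ h₂
    simp only [Fin.ext_iff, ha, hb] at h₁ h₂
    unfold diagCoeff swapCoeff
    simp only [← hσ, posSwap_lt_posSwap_iff hi h₁ h₂,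
      posSwap_lt_posSwap_iff hi (fun h => h₂ h.symm) (fun h => h₁ h.symm), and_self]
  rw [vecMul_Tmat hp]
  by_cases hup : IsAscent κ a b
  · rw [colorAct_of_isAscent _ hup, colorAct_of_isAscent _ hup, vecMul_Tmat hp]
    simp only [Function.comp_apply]
    by_cases hloc : κ ⟨p, by omega⟩ = a ∧ κ ⟨p + 1, hp⟩ = b
    · have hs := comp_posSwap_eq_swap_comp (Or.inl hup) hp hloc.1 hloc.2
      rw [Function.comp_assoc, hs, colorAct_of_isAscent_reverse _ hup.swap_comp, hσσ, hloc.1,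
        hloc.2, Equiv.swap_apply_left, Equiv.swap_apply_right]
      simp [diagCoeff, swapCoeff, hab, hab.not_gt]
    · have hup' : IsAscent (κ ∘ posSwap hp) a b :=
        (hup.comp_posSwap hp).resolve_right fun h => hloc ⟨h.1, h.2.1⟩
      have hloc' : ¬ (κ ⟨p, by omega⟩ = b ∧ κ ⟨p + 1, hp⟩ = a) := by
        obtain ⟨α, β, hαβ, hα, hβ⟩ := hup
        rw [hα, hβ]
        rintro ⟨rfl, rfl⟩
        simp [Fin.lt_def] at hαβ
      rw [(hcoeff hloc hloc').1, (hcoeff hloc hloc').2, colorAct_of_isAscent _ hup',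
        Function.comp_assoc]
  by_cases hdn : IsAscent κ b a
  · rw [colorAct_of_isAscent_reverse _ hdn, colorAct_of_isAscent_reverse _ hdn, vecMul_Tmat hp,
      vecMul_Tmat hp]
    simp only [Function.comp_apply]
    by_cases hloc : κ ⟨p, by omega⟩ = b ∧ κ ⟨p + 1, hp⟩ = a
    · have hs := comp_posSwap_eq_swap_comp (Or.inl hdn) hp hloc.1 hloc.2
      have hdn' := hdn.swap_comp
      rw [Equiv.swap_comm] at hs hdn'
      rw [Function.comp_assoc, hs, colorAct_of_isAscent _ hdn', hσσ, hloc.1,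
        hloc.2, Equiv.swap_apply_left, Equiv.swap_apply_right]
      simp [diagCoeff, swapCoeff, hab, hab.not_gt]
    · have hdn' : IsAscent (κ ∘ posSwap hp) b a :=
        (hdn.comp_posSwap hp).resolve_right fun h => hloc ⟨h.1, h.2.1⟩
      have hloc' : ¬ (κ ⟨p, by omega⟩ = a ∧ κ ⟨p + 1, hp⟩ = b) := by
        obtain ⟨α, β, hαβ, hα, hβ⟩ := hdn
        rw [hα, hβ]
        rintro ⟨rfl, rfl⟩
        simp [Fin.lt_def] at hαβ
      rw [(hcoeff hloc' hloc).1, (hcoeff hloc' hloc).2, colorAct_of_isAscent_reverse _ hdn',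
        Function.comp_assoc]
      ring
  · have hup' : ¬ IsAscent (κ ∘ posSwap hp) a b := fun h => by
      have := h.comp_posSwap hp
      rw [hss] at this
      exact this.elim hup fun h => hdn h.2.2
    have hdn' : ¬ IsAscent (κ ∘ posSwap hp) b a := fun h => by
      have := h.comp_posSwap hp
      rw [hss] at this
      exact this.elim hdn fun h => hup h.2.2
    rw [colorAct_of_not _ hup hdn, colorAct_of_not _ hup' hdn', colorAct_of_not _ hup hdn]
    ring

theorem colorAct_vecMul_Zmat {i : ℕ} (hi : i + 1 < n + 1) (x y : ℕ → F) (f : Lab n → F) :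
    colorAct ⟨i, by omega⟩ ⟨i + 1, hi⟩ f ᵥ* Zmat n x y =
      colorAct ⟨i, by omega⟩ ⟨i + 1, hi⟩ (f ᵥ* Zmat n x y) := by
  have hcol : ∀ (w : F) (j m : ℕ) (f : Lab n → F),
      colorAct ⟨i, by omega⟩ ⟨i + 1, hi⟩ f ᵥ* column (Rmat n) x w j m =
        colorAct ⟨i, by omega⟩ ⟨i + 1, hi⟩ (f ᵥ* column (Rmat n) x w j m) := by
    intro w j m
    induction m with
    | zero => simp [column]
    | succ m ih =>
      intro f
      rw [column, ← vecMul_vecMul, ← vecMul_vecMul, ← ih, vecMul_Rmat, vecMul_Rmat, map_add,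
        map_smul, map_smul, colorAct_vecMul_Tmat]
  rw [Zmat_eq_columns]
  generalize hk : columns (Rmat n) x y n = C
  suffices ∀ k f, colorAct ⟨i, by omega⟩ ⟨i + 1, hi⟩ f ᵥ* C k =
      colorAct ⟨i, by omega⟩ ⟨i + 1, hi⟩ (f ᵥ* C k) from this n f
  subst hk
  intro k
  induction k with
  | zero => simp [columns]
  | succ k ih => intro f; rw [columns, ← vecMul_vecMul, ← vecMul_vecMul, ← hcol, ih]

end Generators

/-! ### Lengths and labelings of permutations -/

section Permutations

variable {n : ℕ}

theorem ell_lt_ell_mul_posSwap {j : ℕ} (hj : j + 1 < n) {v : Equiv.Perm (Fin n)}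
    (h : v ⟨j, Nat.lt_of_succ_lt hj⟩ < v ⟨j + 1, hj⟩) : ell v < ell (v * posSwap hj) := by
  have hinj : Function.Injective (Prod.map (posSwap hj) (posSwap hj)) :=
    (posSwap hj).injective.prodMap (posSwap hj).injective
  unfold ell
  rw [← Finset.card_image_of_injective _ hinj]
  refine Finset.card_lt_card (Finset.ssubset_iff_of_subset ?_ |>.2
    ⟨(⟨j, Nat.lt_of_succ_lt hj⟩, ⟨j + 1, hj⟩), ?_, ?_⟩)
  · intro q hq
    obtain ⟨⟨a, b⟩, hab, rfl⟩ := Finset.mem_image.1 hq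
    simp only [Finset.mem_filter, Finset.mem_univ, true_and] at hab
    refine Finset.mem_filter.2 ⟨Finset.mem_univ _, posSwap_lt_posSwap hj hab.1 fun ⟨h₁, h₂⟩ => ?_,
      by simpa [posSwap_posSwap] using hab.2⟩
    rw [show a = ⟨j, Nat.lt_of_succ_lt hj⟩ from Fin.ext h₁,
      show b = ⟨j + 1, hj⟩ from Fin.ext h₂] at hab
    exact hab.2.not_gt h
  · exact Finset.mem_filter.2 ⟨Finset.mem_univ _, Nat.lt_succ_self j,
      by simpa [posSwap_left, posSwap_right] using h⟩
  · intro hq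
    obtain ⟨⟨a, b⟩, hab, e⟩ := Finset.mem_image.1 hq
    simp only [Finset.mem_filter, Finset.mem_univ, true_and] at hab
    obtain ⟨e₁, e₂⟩ := Prod.mk.inj e
    have ha : a = ⟨j + 1, hj⟩ := by rw [← posSwap_posSwap hj a]; exact e₁ ▸ posSwap_left hj
    have hb : b = ⟨j, Nat.lt_of_succ_lt hj⟩ := by
      rw [← posSwap_posSwap hj b]; exact e₂ ▸ posSwap_right hj
    rw [ha, hb, Fin.lt_def] at hab
    simp at hab

theorem ell_inv (v : Equiv.Perm (Fin n)) : ell v⁻¹ = ell v := by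
  unfold ell
  refine Finset.card_bij' (fun q _ => (v⁻¹ q.2, v⁻¹ q.1)) (fun q _ => (v q.2, v q.1)) ?_ ?_ ?_ ?_
  all_goals simp +contextual

theorem lt_of_ell_lt_ell_mul {j : ℕ} (hj : j + 1 < n) {v : Equiv.Perm (Fin n)}
    (h : ell v < ell (v * posSwap hj)) : v ⟨j, Nat.lt_of_succ_lt hj⟩ < v ⟨j + 1, hj⟩ := by
  by_contra hv
  have hne : v ⟨j + 1, hj⟩ ≠ v ⟨j, Nat.lt_of_succ_lt hj⟩ := v.injective.ne (by simp [Fin.ext_iff])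
  have hlt : (v * posSwap hj) ⟨j, Nat.lt_of_succ_lt hj⟩ < (v * posSwap hj) ⟨j + 1, hj⟩ := by
    rw [Equiv.Perm.mul_apply, Equiv.Perm.mul_apply, posSwap_left, posSwap_right]
    exact lt_of_le_of_ne (not_lt.1 hv) hne
  have := ell_lt_ell_mul_posSwap hj hlt
  rw [mul_assoc, posSwap_mul_self, mul_one] at this
  exact h.not_gt this

theorem lt_of_ell_mul_lt_ell {j : ℕ} (hj : j + 1 < n) {v : Equiv.Perm (Fin n)}
    (h : ell (v * posSwap hj) < ell v) : v ⟨j + 1, hj⟩ < v ⟨j, Nat.lt_of_succ_lt hj⟩ := by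
  have := lt_of_ell_lt_ell_mul hj (v := v * posSwap hj) (by
    rwa [mul_assoc, posSwap_mul_self, mul_one])
  rwa [Equiv.Perm.mul_apply, Equiv.Perm.mul_apply, posSwap_left, posSwap_right] at this

theorem ell_posSwap_mul {i : ℕ} (hi : i + 1 < n) (v : Equiv.Perm (Fin n)) :
    ell (posSwap hi * v) = ell (v⁻¹ * posSwap hi) := by
  rw [← ell_inv, mul_inv_rev, posSwap_inv]

theorem labP_of_lt (v : Equiv.Perm (Fin n)) {p : ℕ} (hp : p < 2 * n) (h : p < n) :
    labP n v ⟨p, hp⟩ = Fin.castSucc (v ⟨p, h⟩) :=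
  dif_pos h

theorem labP_of_le (v : Equiv.Perm (Fin n)) {p : ℕ} (hp : p < 2 * n) (h : n ≤ p) :
    labP n v ⟨p, hp⟩ = Fin.last n :=
  dif_neg h.not_gt

theorem labP_comp_posSwap (v : Equiv.Perm (Fin n)) {j : ℕ} (hj : j + 1 < n)
    (hj' : j + 1 < 2 * n) : labP n v ∘ posSwap hj' = labP n (v * posSwap hj) := by
  funext q
  by_cases h₁ : (q : ℕ) = j
  · obtain rfl : q = ⟨j, Nat.lt_of_succ_lt hj'⟩ := Fin.ext h₁
    rw [Function.comp_apply, posSwap_left, labP_of_lt _ _ hj, labP_of_lt _ _ (by omega),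
      Equiv.Perm.mul_apply, posSwap_left]
  by_cases h₂ : (q : ℕ) = j + 1
  · obtain rfl : q = ⟨j + 1, hj'⟩ := Fin.ext h₂
    rw [Function.comp_apply, posSwap_right, labP_of_lt _ _ hj, labP_of_lt _ _ (by omega),
      Equiv.Perm.mul_apply, posSwap_right]
  rw [Function.comp_apply, posSwap_of_ne hj' h₁ h₂]
  by_cases hq : (q : ℕ) < n
  · rw [labP_of_lt _ _ hq, labP_of_lt _ _ hq, Equiv.Perm.mul_apply, posSwap_of_ne hj h₁ h₂]
  · rw [labP_of_le _ _ (not_lt.1 hq), labP_of_le _ _ (not_lt.1 hq)]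

theorem labP_comp_posSwap_of_le (v : Equiv.Perm (Fin n)) {j : ℕ} (hj : n ≤ j)
    (hj' : j + 1 < 2 * n) : labP n v ∘ posSwap hj' = labP n v := by
  funext q
  by_cases h₁ : (q : ℕ) = j
  · obtain rfl : q = ⟨j, Nat.lt_of_succ_lt hj'⟩ := Fin.ext h₁
    rw [Function.comp_apply, posSwap_left, labP_of_le _ _ hj, labP_of_le _ _ (by omega)]
  by_cases h₂ : (q : ℕ) = j + 1
  · obtain rfl : q = ⟨j + 1, hj'⟩ := Fin.ext h₂
    rw [Function.comp_apply, posSwap_right, labP_of_le _ _ hj, labP_of_le _ _ (by omega)]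
  rw [Function.comp_apply, posSwap_of_ne hj' h₁ h₂]

theorem swap_castSucc_comp_labP (v : Equiv.Perm (Fin n)) (a b : Fin n) :
    Equiv.swap a.castSucc b.castSucc ∘ labP n v = labP n (Equiv.swap a b * v) := by
  funext q
  rw [Function.comp_apply]
  by_cases hq : (q : ℕ) < n
  · rw [labP_of_lt _ _ hq, labP_of_lt _ _ hq, Equiv.Perm.mul_apply]
    exact (Fin.castSucc_injective n).swap_apply _ _ _
  · rw [labP_of_le _ _ (not_lt.1 hq), labP_of_le _ _ (not_lt.1 hq)]
    exact Equiv.swap_apply_of_ne_of_ne (Fin.castSucc_lt_last a).ne' (Fin.castSucc_lt_last b).ne'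

theorem isAscent_labP {v : Equiv.Perm (Fin n)} {a b : Fin n} (h : v⁻¹ a < v⁻¹ b) :
    IsAscent (labP n v) a.castSucc b.castSucc := by
  have key : ∀ (c : Fin n) (q : Fin (2 * n)), labP n v q = c.castSucc ↔
      q = Fin.castLE (by omega) (v⁻¹ c) := by
    intro c q
    by_cases hq : (q : ℕ) < n
    · rw [labP_of_lt _ _ hq, (Fin.castSucc_injective n).eq_iff, ← Equiv.Perm.eq_inv_iff_eq]
      simp [Fin.ext_iff]
    · rw [labP_of_le _ _ (not_lt.1 hq)]
      refine iff_of_false (Fin.castSucc_lt_last c).ne' fun e => hq ?_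
      rw [e]
      exact (v⁻¹ c).2
  exact ⟨_, _, h, key a, key b⟩

end Permutations

/-! ### Exchange relations -/

section Exchange

open Matrix

variable {n : ℕ}

theorem gen_ne_zero (i : ℕ) : gen i ≠ 0 := by
  rw [gen, Ne, FaithfulSMul.algebraMap_eq_zero_iff]
  exact MvPolynomial.X_ne_zero i

/-- The row vector `⟨1|`. -/
def idRow (n : ℕ) : Lab n → F := Pi.single (labP n 1) 1

theorem idRow_vecMul (M : Mat n) (κ : Lab n) : (idRow n ᵥ* M) κ = M (labP n 1) κ := by
  rw [idRow, single_one_vecMul, Matrix.row_apply]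

theorem idRow_vecMul_Tmat_of_le {p : ℕ} (hp : n ≤ p) (hp' : p + 1 < 2 * n) :
    idRow n ᵥ* Tmat n p = tt • idRow n := by
  funext κ
  rw [vecMul_Tmat hp', Pi.smul_apply, smul_eq_mul]
  by_cases h : κ = labP n 1
  · subst h
    rw [labP_comp_posSwap_of_le 1 hp hp', labP_of_le _ _ hp, labP_of_le _ _ (by omega)]
    simp [diagCoeff, swapCoeff]
  · have h' : κ ∘ posSwap hp' ≠ labP n 1 := fun e => h <| by
      rw [← labP_comp_posSwap_of_le 1 hp hp', ← e]
      exact funext fun j => by simp [posSwap_posSwap]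
    simp [idRow, h, h']

theorem idRow_vecMul_Tmat_of_lt {i : ℕ} (hi : i + 1 < n) :
    idRow n ᵥ* Tmat n i =
      colorAct (Fin.castSucc ⟨i, Nat.lt_of_succ_lt hi⟩) (Fin.castSucc ⟨i + 1, hi⟩) (idRow n) := by
  have hi' : i + 1 < 2 * n := by omega
  set s : Equiv.Perm (Fin n) := posSwap hi with hs
  have e₁ : labP n 1 ∘ posSwap hi' = labP n s := by rw [labP_comp_posSwap 1 hi hi', one_mul]
  let σ := Equiv.swap (Fin.castSucc (⟨i, Nat.lt_of_succ_lt hi⟩ : Fin n))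
    (Fin.castSucc ⟨i + 1, hi⟩)
  have e₂ : σ ∘ labP n 1 = labP n s := by
    unfold σ; rw [swap_castSucc_comp_labP, mul_one]; rfl
  have e₁' : labP n s ∘ posSwap hi' = labP n 1 := by
    rw [← e₁]; exact funext fun j => by simp [posSwap_posSwap]
  have e₂' : σ ∘ labP n s = labP n 1 := by
    rw [← e₂]; exact funext fun j => by simp [σ]
  have hlt : (⟨i, Nat.lt_of_succ_lt hi⟩ : Fin n) < ⟨i + 1, hi⟩ := by simp [Fin.lt_def]
  have hne : labP n s ≠ labP n 1 := fun e => by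
    have := congrFun e ⟨i, Nat.lt_of_succ_lt hi'⟩
    rw [labP_of_lt _ _ (by omega), labP_of_lt _ _ (by omega), hs, posSwap_left,
      Equiv.Perm.one_apply] at this
    exact hlt.ne' (Fin.castSucc_injective n this)
  funext κ
  rw [vecMul_Tmat hi']
  by_cases h₁ : κ = labP n 1
  · subst h₁
    rw [colorAct_of_isAscent _ (isAscent_labP hlt), e₁, e₂,
      labP_of_lt _ _ (by omega), labP_of_lt _ _ hi]
    simp [idRow, hne, diagCoeff]
  by_cases h₂ : κ = labP n s
  · subst h₂
    rw [colorAct_of_isAscent_reverse _ (isAscent_labP (by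
      rw [hs, posSwap_inv, posSwap_left, posSwap_right]; exact hlt)), e₁', e₂',
      labP_of_lt _ _ (by omega), labP_of_lt _ _ hi, hs, posSwap_left, posSwap_right]
    have h₁' : labP n (posSwap hi) ≠ labP n 1 := h₁
    simp [idRow, h₁', swapCoeff]
  have h₃ : κ ∘ posSwap hi' ≠ labP n 1 := fun e => h₂ <| by
    rw [← e₁, ← e]; exact funext fun j => by simp [posSwap_posSwap]
  have h₄ : σ ∘ κ ≠ labP n 1 :=
    fun e => h₂ <| by rw [← e₂, ← e]; exact funext fun j => by simp [σ]
  simp only [σ] at h₄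
  have hz : colorAct (Fin.castSucc ⟨i, Nat.lt_of_succ_lt hi⟩) (Fin.castSucc ⟨i + 1, hi⟩)
      (idRow n) κ = 0 := by
    simp only [colorAct, LinearMap.coe_mk, AddHom.coe_mk, idRow, Pi.single_eq_of_ne h₁,
      Pi.single_eq_of_ne h₄, mul_zero, add_zero, ite_self]
  rw [hz]
  simp [idRow, h₁, h₃]

theorem Fv_eq_idRow_vecMul (x y : ℕ → F) (v : Equiv.Perm (Fin n)) :
    Fv n x y v = (idRow n ᵥ* Zmat n x y) (labP n v) :=
  (idRow_vecMul _ _).symm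

theorem Fv_exchange_right {x y : ℕ → F} {j : ℕ} (hj : j + 1 < n) (hy : y j ≠ 0)
    (v : Equiv.Perm (Fin n)) :
    (1 - tt * (y j / y (j + 1))) * Fv n x (swapSeq y j) v =
      (1 - tt) * Fv n x y v + (1 - y j / y (j + 1)) *
        (diagCoeff (v ⟨j, Nat.lt_of_succ_lt hj⟩) (v ⟨j + 1, hj⟩) * Fv n x y v +
          swapCoeff (v ⟨j, Nat.lt_of_succ_lt hj⟩) (v ⟨j + 1, hj⟩) * Fv n x y (v * posSwap hj)) := by
  have hj' : j + 1 < 2 * n := by omega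
  have h := columns_mul_of_swapSeq_right (R := Rmat n) (x := x) Rmat_comm Rmat_yangBaxter hy n n
    hj (by omega)
  rw [← Zmat_eq_columns, ← Zmat_eq_columns] at h
  have h := congrFun (congrArg (idRow n ᵥ* ·) h) (labP n v)
  simp only [← vecMul_vecMul] at h
  rw [vecMul_Rmat, vecMul_Rmat, idRow_vecMul_Tmat_of_le (by omega) (by omega), add_vecMul,
    smul_vecMul, smul_vecMul, smul_vecMul] at h
  simp only [Pi.add_apply, Pi.smul_apply, smul_eq_mul] at h
  rw [vecMul_Tmat hj', labP_comp_posSwap v hj hj', labP_of_lt _ _ (by omega),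
    labP_of_lt _ _ hj] at h
  simp only [← Fv_eq_idRow_vecMul] at h
  simp only [diagCoeff, swapCoeff, Fin.castSucc_lt_castSucc_iff] at h ⊢
  rw [h]
  ring

theorem Fv_exchange_left {x y : ℕ → F} {i : ℕ} (hi : i + 1 < n) (hx : x i ≠ 0)
    (v : Equiv.Perm (Fin n)) :
    (1 - tt * (x (i + 1) / x i)) * Fv n (swapSeq x i) y v =
      (1 - tt) * Fv n x y v + (1 - x (i + 1) / x i) *
        colorAct (Fin.castSucc ⟨i, Nat.lt_of_succ_lt hi⟩) (Fin.castSucc ⟨i + 1, hi⟩)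
          (idRow n ᵥ* Zmat n x y) (labP n v) := by
  have hss : swapSeq (swapSeq x i) i = x := by
    funext k
    simp only [swapSeq]
    split_ifs <;> simp_all
  have h := columns_mul_of_swapSeq_left (R := Rmat n) (x := swapSeq x i) (y := y) (i := i)
    Rmat_comm Rmat_yangBaxter (by simpa [swapSeq] using hx) n n hi (by omega)
  rw [hss, ← Zmat_eq_columns, ← Zmat_eq_columns] at h
  have h := congrFun (congrArg (idRow n ᵥ* ·) h) (labP n v)
  simp only [← vecMul_vecMul] at h
  rw [vecMul_Rmat, vecMul_Rmat, idRow_vecMul_Tmat_of_lt hi, add_vecMul, smul_vecMul,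
    smul_vecMul] at h
  have hS := colorAct_vecMul_Zmat (show i + 1 < n + 1 by omega) x y (idRow n)
  simp only [Fin.castSucc_mk] at h ⊢
  rw [hS] at h
  simp only [Pi.add_apply, Pi.smul_apply, smul_eq_mul] at h
  rw [vecMul_Tmat (by omega), labP_comp_posSwap_of_le v (by omega), labP_of_le _ _ (by omega),
    labP_of_le _ _ (by omega)] at h
  simp only [← Fv_eq_idRow_vecMul, diagCoeff, swapCoeff, lt_irrefl, if_false, swapSeq, if_true,
    Nat.succ_ne_self] at h ⊢
  rw [← h]
  ring

end Exchange

/-- the exchange relations for the matrix elements `F_v` (variables not specialized). -/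
theorem statement11 (n : ℕ) (hn : 1 ≤ n) (v : Equiv.Perm (Fin n)) :
    (∀ i : ℕ, ∀ hi : i + 1 < n, ∀ s : Equiv.Perm (Fin n),
        s = Equiv.swap (⟨i, by omega⟩ : Fin n) ⟨i + 1, hi⟩ →
        (ell (s * v) > ell v →
            (1 - tt * xx (i + 1) / xx i) *
                Fv n (fun k => if k = i then xx (i + 1) else if k = i + 1 then xx i else xx k)
                  yy v =
              (1 - tt) * Fv n xx yy v + (1 - xx (i + 1) / xx i) * Fv n xx yy (s * v)) ∧
          (ell (s * v) < ell v →
            (1 - tt * xx (i + 1) / xx i) *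
                Fv n (fun k => if k = i then xx (i + 1) else if k = i + 1 then xx i else xx k)
                  yy v =
              (1 - tt) * (xx (i + 1) / xx i) * Fv n xx yy v +
                tt * (1 - xx (i + 1) / xx i) * Fv n xx yy (s * v))) ∧
      ∀ j : ℕ, ∀ hj : j + 1 < n, ∀ s : Equiv.Perm (Fin n),
        s = Equiv.swap (⟨j, by omega⟩ : Fin n) ⟨j + 1, hj⟩ →
        (ell (v * s) > ell v →
            (1 - tt * yy j / yy (j + 1)) *
                Fv n xx (fun k => if k = j then yy (j + 1) else if k = j + 1 then yy j else yy k)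
                  v =
              (1 - tt) * Fv n xx yy v + (1 - yy j / yy (j + 1)) * Fv n xx yy (v * s)) ∧
          (ell (v * s) < ell v →
            (1 - tt * yy j / yy (j + 1)) *
                Fv n xx (fun k => if k = j then yy (j + 1) else if k = j + 1 then yy j else yy k)
                  v =
              (1 - tt) * (yy j / yy (j + 1)) * Fv n xx yy v +
                tt * (1 - yy j / yy (j + 1)) * Fv n xx yy (v * s)) := by
  refine ⟨fun i hi s hs => ?_, fun j hj s hs => ?_⟩
  · replace hs : s = posSwap hi := hs
    have h := Fv_exchange_left (x := xx) (y := yy) hi (gen_ne_zero _ : xx i ≠ 0) v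
    have hcomp : Equiv.swap (Fin.castSucc ⟨i, by omega⟩) (Fin.castSucc ⟨i + 1, hi⟩) ∘ labP n v =
        labP n (s * v) := by
      rw [hs, swap_castSucc_comp_labP]; rfl
    rw [mul_div_assoc, h]
    refine ⟨fun hl => ?_, fun hl => ?_⟩
    · rw [hs, ell_posSwap_mul, ← ell_inv v] at hl
      rw [colorAct_of_isAscent _ (isAscent_labP (lt_of_ell_lt_ell_mul hi hl)), hcomp,
        Fv_eq_idRow_vecMul xx yy (s * v)]
    · rw [hs, ell_posSwap_mul, ← ell_inv v] at hl
      rw [colorAct_of_isAscent_reverse _ (isAscent_labP (lt_of_ell_mul_lt_ell hi hl)), hcomp,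
        Fv_eq_idRow_vecMul xx yy (s * v), Fv_eq_idRow_vecMul xx yy v]
      ring
  · replace hs : s = posSwap hj := hs
    have h := Fv_exchange_right (x := xx) (y := yy) hj (gen_ne_zero _ : yy j ≠ 0) v
    rw [mul_div_assoc, h, hs]
    refine ⟨fun hl => ?_, fun hl => ?_⟩
    · have hlt := lt_of_ell_lt_ell_mul hj hl
      rw [diagCoeff, swapCoeff, if_neg hlt.not_gt, if_pos hlt]
      ring
    · have hlt := lt_of_ell_mul_lt_ell hj hl
      rw [diagCoeff, swapCoeff, if_pos hlt, if_neg hlt.not_gt]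
      ring
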